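/- For every complex z with Re z > 0 and z ≠ 1, one has G(z) = (1 - 2^{1-z}) · Γ(z) · ζ(z), where Γ is the Gamma function and ζ is the Riemann zeta function. -/

import Mathlib

open MeasureTheory

/-- `G z = ∫₀^∞ ξ^(z-1) / (exp ξ + 1) dξ`. -/
noncomputable def G (z : ℂ) : ℂ :=
  ∫ ξ in Set.Ioi (0 : ℝ), (ξ : ℂ) ^ (z - 1) / (Real.exp ξ + 1)

theorem G_eq_mellin : G = mellin fun t : ℝ => ((Real.exp t : ℂ) + 1)⁻¹ := by
  funext s
  simp [G, mellin, div_eq_mul_inv]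

open Filter Asymptotics Topology in
theorem differentiableAt_G {z : ℂ} (hz : 0 < z.re) : DifferentiableAt ℂ G z := by
  have hnorm (t : ℝ) : ‖((Real.exp t : ℂ) + 1)⁻¹‖ = (Real.exp t + 1)⁻¹ := by
    rw [norm_inv, ← Complex.ofReal_one, ← Complex.ofReal_add, Complex.norm_real,
      Real.norm_of_nonneg (by positivity)]
  have hne (t : ℝ) : (Real.exp t : ℂ) + 1 ≠ 0 := by
    exact_mod_cast (by positivity : Real.exp t + 1 ≠ 0)
  rw [G_eq_mellin]
  refine mellin_differentiableAt_of_isBigO_rpow_exp (a := 1) (b := 0) one_pos ?_ ?_ ?_ hz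
  · refine (Continuous.inv₀ ?_ hne).locallyIntegrable.locallyIntegrableOn _
    fun_prop
  · refine IsBigO.of_bound 1 (Eventually.of_forall fun t => ?_)
    rw [hnorm, one_mul, neg_one_mul, Real.norm_of_nonneg (Real.exp_pos _).le, Real.exp_neg]
    gcongr
    linarith
  · refine IsBigO.of_bound 1 (Eventually.of_forall fun t => ?_)
    rw [hnorm, neg_zero, Real.rpow_zero, norm_one, mul_one]
    exact inv_le_one_of_one_le₀ (by linarith [Real.exp_pos t])

theorem hasSum_exp_neg_nat_add_one_mul {t : ℝ} (ht : 0 < t) :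
    HasSum (fun n : ℕ => Real.exp (-(n + 1) * t)) (Real.exp t - 1)⁻¹ := by
  have h := (hasSum_geometric_of_lt_one (Real.exp_pos (-t)).le
    (by simpa using ht)).mul_left (Real.exp (-t))
  have h1 : Real.exp t - 1 ≠ 0 := (sub_pos.mpr (Real.one_lt_exp_iff.mpr ht)).ne'
  convert! h using 1
  · funext n
    rw [← Real.exp_nat_mul, ← Real.exp_add]
    ring_nf
  · rw [Real.exp_neg, ← mul_inv]
    congr 1
    field_simp

theorem G_eq_of_one_lt_re {z : ℂ} (hz : 1 < z.re) :
    G z = (1 - (2 : ℂ) ^ (1 - z)) * Complex.Gamma z * riemannZeta z := by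
  have hζ : HasSum (fun n : ℕ => 1 / ((n : ℂ) + 1) ^ z) (riemannZeta z) := by
    rw [zeta_eq_tsum_one_div_nat_add_one_cpow hz]
    refine Summable.hasSum ?_
    simpa using (summable_nat_add_iff 1).mpr (Complex.summable_one_div_nat_cpow.mpr hz)
  have hreal : Summable fun n : ℕ => 1 / ((n : ℝ) + 1) ^ z.re := by
    simpa using (summable_nat_add_iff 1).mpr (Real.summable_one_div_nat_rpow.mpr hz)
  let a : ℕ ⊕ ℕ → ℂ := Sum.elim (fun _ => 1) (fun _ => -2)
  let p : ℕ ⊕ ℕ → ℝ := Sum.elim (fun n => n + 1) (fun n => 2 * (n + 1))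
  have hmellin : HasSum (fun i => Complex.Gamma z * a i / (p i : ℂ) ^ z)
      (mellin (fun t : ℝ => ((Real.exp t : ℂ) + 1)⁻¹) z) := by
    refine hasSum_mellin (fun i => Or.inr ?_) (by linarith) (fun t ht => ?_) ?_
    · rcases i with n | n <;> simp only [p, Sum.elim_inl, Sum.elim_inr] <;> positivity
    · have ht : 0 < t := ht
      have h1 := Complex.hasSum_ofReal.mpr (hasSum_exp_neg_nat_add_one_mul ht)
      have h2 := (Complex.hasSum_ofReal.mpr
        (hasSum_exp_neg_nat_add_one_mul (mul_pos two_pos ht))).mul_left (-2)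
      have hsum := HasSum.sum (f := fun i => a i * (Real.exp (-p i * t) : ℂ))
        (by
          convert! h1 using 1
          funext n
          simp only [Function.comp_def, a, p, Sum.elim_inl, one_mul])
        (by
          convert! h2 using 1
          funext n
          simp only [Function.comp_def, a, p, Sum.elim_inr]
          ring_nf)
      convert! hsum using 1
      have hpos : Real.exp t - 1 ≠ 0 := (sub_pos.mpr (Real.one_lt_exp_iff.mpr ht)).ne'
      have hpos' : Real.exp t + 1 ≠ 0 := by positivity
      have hexp : Real.exp (2 * t) - 1 = (Real.exp t - 1) * (Real.exp t + 1) := by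
        rw [two_mul, Real.exp_add]
        ring
      rw [hexp]
      have hfrac : (Real.exp t + 1)⁻¹ =
          (Real.exp t - 1)⁻¹ + -2 * ((Real.exp t - 1) * (Real.exp t + 1))⁻¹ := by
        field_simp
        ring
      exact_mod_cast congrArg Complex.ofReal hfrac
    · refine Summable.sum _ ?_ ?_
      · simpa [Function.comp_def, a, p] using hreal
      · refine (hreal.mul_left (2 / 2 ^ z.re)).congr fun n => ?_
        simp only [Function.comp_def, a, p, Sum.elim_inr, norm_neg, Complex.norm_ofNat]
        rw [Real.mul_rpow two_pos.le (by positivity)]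
        ring
  rw [G_eq_mellin]
  refine hmellin.unique ?_
  have h := HasSum.sum (f := fun i => Complex.Gamma z * a i / (p i : ℂ) ^ z)
    (a := Complex.Gamma z * riemannZeta z)
    (b := Complex.Gamma z * (-2) / 2 ^ z * riemannZeta z) ?_ ?_
  · convert! h using 1
    rw [Complex.cpow_sub _ _ two_ne_zero, Complex.cpow_one]
    ring
  · convert! hζ.mul_left (Complex.Gamma z) using 1
    funext n
    simp [a, p, div_eq_mul_inv]
  · convert! hζ.mul_left (Complex.Gamma z * (-2) / 2 ^ z) using 1
    funext n
    have hcast : ((2 * ((n : ℝ) + 1) : ℝ) : ℂ) ^ z = 2 ^ z * ((n : ℂ) + 1) ^ z := by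
      rw [Complex.ofReal_mul, Complex.mul_cpow_ofReal_nonneg two_pos.le (by positivity)]
      push_cast
      rfl
    simp only [Function.comp_def, a, p, Sum.elim_inr, hcast]
    ring

theorem sub_one_mul_riemannZeta {z : ℂ} (hz : z ≠ 0) (hz1 : z ≠ 1) :
    (z - 1) * riemannZeta z =
      ((z - 1) * completedRiemannZeta₀ z - (z - 1) / z + 1) * (Complex.Gammaℝ z)⁻¹ := by
  have h1 : 1 - z ≠ 0 := sub_ne_zero.mpr hz1.symm
  rw [riemannZeta_def_of_ne_zero hz, completedRiemannZeta_eq]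
  field_simp
  ring

theorem G_eq_eta_factor_mul_Gamma_mul_zeta (z : ℂ) (hz : 0 < z.re) (hz1 : z ≠ 1) :
    G z = (1 - (2 : ℂ) ^ (1 - z)) * Complex.Gamma z * riemannZeta z := by
  let U : Set ℂ := {s | 0 < s.re}
  have hU : IsOpen U := isOpen_lt continuous_const Complex.continuous_re
  have hne {s : ℂ} (hs : 0 < s.re) : s ≠ 0 := by
    rintro rfl
    simp at hs
  let F : ℂ → ℂ := fun s => (s - 1) * G s
  let H : ℂ → ℂ := fun s => (1 - (2 : ℂ) ^ (1 - s)) * Complex.Gamma s *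
    (((s - 1) * completedRiemannZeta₀ s - (s - 1) / s + 1) * (Complex.Gammaℝ s)⁻¹)
  have hF : DifferentiableOn ℂ F U := fun s hs =>
    ((differentiableAt_id.sub_const 1).mul (differentiableAt_G hs)).differentiableWithinAt
  have hH : DifferentiableOn ℂ H U := fun s hs => by
    have hΓ : DifferentiableAt ℂ Complex.Gamma s :=
      Complex.differentiableAt_Gamma s fun m hm => by
        have hs : 0 < s.re := hs
        have := m.cast_nonneg (α := ℝ)
        simp only [hm, Complex.neg_re, Complex.natCast_re] at hs
        linarith
    have hΛ := differentiable_completedZeta₀.differentiableAt (x := s)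
    have hR := Complex.differentiable_Gammaℝ_inv.differentiableAt (x := s)
    have hs0 := hne hs
    have hpow : DifferentiableAt ℂ (fun s : ℂ => (2 : ℂ) ^ (1 - s)) s :=
      (differentiableAt_id.const_sub 1).const_cpow (Or.inl two_ne_zero)
    refine DifferentiableAt.differentiableWithinAt ?_
    fun_prop (disch := assumption)
  have hFH : F =ᶠ[nhds 2] H := by
    have hV : {s : ℂ | 1 < s.re} ∈ nhds (2 : ℂ) :=
      (isOpen_lt continuous_const Complex.continuous_re).mem_nhds (by simp)
    filter_upwards [hV] with s (hs : 1 < s.re)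
    have hs1 : s ≠ 1 := by
      rintro rfl
      simp at hs
    simp only [F, H]
    rw [← sub_one_mul_riemannZeta (hne (by linarith)) hs1, G_eq_of_one_lt_re hs]
    ring
  have h : F z = H z := (hF.analyticOnNhd hU).eqOn_of_preconnected_of_eventuallyEq
    (hH.analyticOnNhd hU) (convex_halfSpace_re_gt 0).isPreconnected
    (show (2 : ℂ) ∈ U by simp [U]) hFH hz
  simp only [F, H] at h
  rw [← sub_one_mul_riemannZeta (hne hz) hz1] at h
  refine mul_left_cancel₀ (sub_ne_zero.mpr hz1) ?_
  rw [h]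
  ring
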